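/- Let Q be a finite quiver without sources and A = kQ/J². The cokernel complex C• of the inclusion K• ↪ P• decomposes as a direct sum C• = ⊕_{n ≥ 0} C•_n of bounded-above subcomplexes, where C^l_n = ⊕_{i ∈ Q₀} P_i^{(Λ^{l,n−l}_i)} for l < n and C^l_n = 0 for l ≥ n. -/

import Mathlib

noncomputable section

/-- A finite quiver: finite sets of vertices and arrows, with source and target maps. -/
structure FQ where
  V : Type
  E : Type
  [fV : Fintype V]
  [fE : Fintype E]
  [dV : DecidableEq V]
  [dE : DecidableEq E]
  s : E → V
  t : E → V

attribute [instance] FQ.fV FQ.fE FQ.dV FQ.dE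

/-- `Q` has no sources: every vertex admits an arrow terminating at it. -/
def FQ.NoSources (Q : FQ) : Prop := ∀ i : Q.V, ∃ e : Q.E, Q.t e = i

/-- The opposite quiver. -/
def FQ.op (Q : FQ) : FQ := { V := Q.V, E := Q.E, s := Q.t, t := Q.s }

/-- Paths in the quiver `Q` from a vertex to a vertex; `cons p e he` is the path
`e ∘ p` obtained by composing an arrow `e` after the path `p` (paths are written
from right to left). -/
inductive QP (Q : FQ) : Q.V → Q.V → Type
  | nil (i : Q.V) : QP Q i i
  | cons {i j : Q.V} (p : QP Q i j) (e : Q.E) (he : Q.s e = j) : QP Q i (Q.t e)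

namespace QP

variable {Q : FQ}

/-- The length of a path. -/
def length : ∀ {i j : Q.V}, QP Q i j → ℕ
  | _, _, .nil _ => 0
  | _, _, .cons p _ _ => length p + 1

/-- The first (rightmost) arrow of a path, if any. -/
def firstArrow : ∀ {i j : Q.V}, QP Q i j → Option Q.E
  | _, _, .nil _ => none
  | _, _, .cons p e _ => some ((firstArrow p).getD e)

/-- The last (leftmost) arrow of a path, if any. -/
def lastArrow : ∀ {i j : Q.V}, QP Q i j → Option Q.E
  | _, _, .nil _ => none
  | _, _, .cons _ e _ => some e

/-- Transport of a path along an equality of its starting vertices. -/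
def castSrc {i i' j : Q.V} (h : i = i') (p : QP Q i j) : QP Q i' j := h ▸ p

/-- Extend a path at its starting vertex by an arrow (`p ↦ p ∘ e`). -/
def preCons (e : Q.E) : ∀ {j : Q.V}, QP Q (Q.t e) j → QP Q (Q.s e) j
  | _, .nil _ => .cons (.nil (Q.s e)) e rfl
  | _, .cons p f hf => .cons (preCons e p) f hf

lemma length_castSrc {i i' j : Q.V} (h : i = i') (p : QP Q i j) :
    (castSrc h p).length = p.length := by subst h; rfl

lemma length_preCons (e : Q.E) : ∀ {j : Q.V} (p : QP Q (Q.t e) j),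
    (preCons e p).length = p.length + 1
  | _, .nil _ => by simp [preCons, length]
  | _, .cons p f hf => by
      show (QP.cons (preCons e p) f hf).length = _
      simp [length, length_preCons e p]

end QP

/-- With respect to a choice `asc` of an *associated* arrow terminating at each
non-source vertex, `IsAssoc Q asc a` says that the arrow `a` is the associated arrow
terminating at its target. -/
def IsAssoc (Q : FQ) (asc : ∀ i : Q.V, (∃ e, Q.t e = i) → Q.E) (a : Q.E) : Prop :=
  asc (Q.t a) ⟨a, rfl⟩ = a

/-- `(p, q)` is an *associated pair*: the paths `p` and `q` start at the same vertex,
and either one of them is trivial, or their first arrows differ, or their common first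
arrow is not associated. -/
def AssocPair (Q : FQ) (asc : ∀ i : Q.V, (∃ e, Q.t e = i) → Q.E)
    {i j j' : Q.V} (p : QP Q i j) (q : QP Q i j') : Prop :=
  ∀ a : Q.E, p.firstArrow = some a → q.firstArrow = some a → ¬ IsAssoc Q asc a

lemma assocPair_nil_left {Q : FQ} {asc : ∀ i : Q.V, (∃ e, Q.t e = i) → Q.E}
    {i j : Q.V} (q : QP Q i j) : AssocPair Q asc (QP.nil i) q := by
  intro a h
  simp [QP.firstArrow] at h

lemma assocPair_nil_right {Q : FQ} {asc : ∀ i : Q.V, (∃ e, Q.t e = i) → Q.E}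
    {i j : Q.V} (p : QP Q i j) : AssocPair Q asc p (QP.nil i) := by
  intro a _ h
  simp [QP.firstArrow] at h

/-- The index set `Λ^l_i` (for `i = x.i`): associated pairs `(p, q)` with
`t(p) = i` and `l(q) - l(p) = l`. -/
structure Lam (Q : FQ) (asc : ∀ i : Q.V, (∃ e, Q.t e = i) → Q.E) (l : ℤ) where
  a : Q.V              -- the common starting vertex of `p` and `q`
  i : Q.V              -- the terminating vertex of `p`
  b : Q.V              -- the terminating vertex of `q`
  p : QP Q a i
  q : QP Q a b
  ok : AssocPair Q asc p q
  deg : (q.length : ℤ) - (p.length : ℤ) = l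

instance {Q : FQ} {asc : ∀ i : Q.V, (∃ e, Q.t e = i) → Q.E} {l : ℤ} :
    DecidableEq (Lam Q asc l) := Classical.decEq _
/-- Generators of the path algebra `kQ`. -/
inductive AGen (Q : FQ)
  | vtx (i : Q.V)
  | ar (e : Q.E)

/-- The defining relations of the radical square zero algebra `A = kQ/J²`:
the trivial paths are orthogonal idempotents summing to the unit, arrows are unital
with respect to the trivial paths at their endpoints, and any product of two arrows
vanishes. -/
inductive ARel (k : Type) [Field k] (Q : FQ) :
    FreeAlgebra k (AGen Q) → FreeAlgebra k (AGen Q) → Prop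
  | vtx_mul (i j : Q.V) :
      ARel k Q (FreeAlgebra.ι k (AGen.vtx i) * FreeAlgebra.ι k (AGen.vtx j))
        (if i = j then FreeAlgebra.ι k (AGen.vtx i) else 0)
  | sum_vtx : ARel k Q (∑ i : Q.V, FreeAlgebra.ι k (AGen.vtx i)) 1
  | vtx_ar (e : Q.E) :
      ARel k Q (FreeAlgebra.ι k (AGen.vtx (Q.t e)) * FreeAlgebra.ι k (AGen.ar e))
        (FreeAlgebra.ι k (AGen.ar e))
  | ar_vtx (e : Q.E) :
      ARel k Q (FreeAlgebra.ι k (AGen.ar e) * FreeAlgebra.ι k (AGen.vtx (Q.s e)))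
        (FreeAlgebra.ι k (AGen.ar e))
  | rad_sq (e f : Q.E) :
      ARel k Q (FreeAlgebra.ι k (AGen.ar e) * FreeAlgebra.ι k (AGen.ar f)) 0

/-- The radical square zero algebra `A = kQ/J²` of the finite quiver `Q`. -/
abbrev AlgA (k : Type) [Field k] (Q : FQ) := RingQuot (ARel k Q)

/-- The image `e_i` in `A` of the trivial path at the vertex `i`. -/
def vtxA (k : Type) [Field k] (Q : FQ) (i : Q.V) : AlgA k Q :=
  RingQuot.mkAlgHom k (ARel k Q) (FreeAlgebra.ι k (AGen.vtx i))

/-- The image `α` in `A` of an arrow `α`. -/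
def arA (k : Type) [Field k] (Q : FQ) (e : Q.E) : AlgA k Q :=
  RingQuot.mkAlgHom k (ARel k Q) (FreeAlgebra.ι k (AGen.ar e))

lemma arA_mul_vtxA (k : Type) [Field k] (Q : FQ) (e : Q.E) :
    arA k Q e * vtxA k Q (Q.s e) = arA k Q e := by
  have h := RingQuot.mkAlgHom_rel k (ARel.ar_vtx (k := k) (Q := Q) e)
  simpa [vtxA, arA, map_mul] using h

/-- The indecomposable projective left `A`-module `P_i = A e_i`. -/
def Pmod (k : Type) [Field k] (Q : FQ) (i : Q.V) : Submodule (AlgA k Q) (AlgA k Q) :=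
  Submodule.span (AlgA k Q) {vtxA k Q i}

lemma vtxA_mem (k : Type) [Field k] (Q : FQ) (i : Q.V) : vtxA k Q i ∈ Pmod k Q i :=
  Submodule.mem_span_singleton_self _

lemma arA_mem (k : Type) [Field k] (Q : FQ) (e : Q.E) {i : Q.V} (he : Q.s e = i) :
    arA k Q e ∈ Pmod k Q i := by
  subst he
  rw [← arA_mul_vtxA k Q e]
  simpa [smul_eq_mul] using
    Submodule.smul_mem (Pmod k Q (Q.s e)) (arA k Q e) (vtxA_mem k Q (Q.s e))

/-- The `l`-th component `P^l = ⊕_{i ∈ Q₀} P_i^{(Λ^l_i)}` of the projective Leavitt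
complex. -/
abbrev PL (k : Type) [Field k] (Q : FQ) (asc : ∀ i : Q.V, (∃ e, Q.t e = i) → Q.E)
    (l : ℤ) : Type :=
  Π₀ x : Lam Q asc l, ↥(Pmod k Q x.i)

instance PL.instAddCommGroup (k : Type) [Field k] (Q : FQ)
    (asc : ∀ i : Q.V, (∃ e, Q.t e = i) → Q.E) (l : ℤ) :
    AddCommGroup (PL k Q asc l) :=
  @DFinsupp.addCommGroup (Lam Q asc l) (fun x => ↥(Pmod k Q x.i)) (fun _ => inferInstance)
/-- The basis element `e_i ζ_{(p,q)}` of `P^l`, for `x = (p, q) ∈ Λ^l_i`. -/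
def zE {k : Type} [Field k] {Q : FQ} {asc : ∀ i : Q.V, (∃ e, Q.t e = i) → Q.E}
    {l : ℤ} (x : Lam Q asc l) : PL k Q asc l :=
  DFinsupp.single x ⟨vtxA k Q x.i, vtxA_mem k Q x.i⟩

/-- The basis element `α ζ_{(p,q)}` of `P^l`, for `x = (p, q) ∈ Λ^l_i` and an arrow
`α` with `s(α) = i`. -/
def zA {k : Type} [Field k] {Q : FQ} {asc : ∀ i : Q.V, (∃ e, Q.t e = i) → Q.E}
    {l : ℤ} (x : Lam Q asc l) (e : Q.E) (he : Q.s e = x.i) : PL k Q asc l :=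
  DFinsupp.single x ⟨arA k Q e, arA_mem k Q e he⟩

/-- The family of `A`-linear maps `δ^l : P^l → P^{l+1}` is *the differential of the
projective Leavitt complex* when it satisfies the defining formulas:
`δ^l(α ζ_{(p,q)}) = 0`; `δ^l(e_i ζ_{(βp̂, q)}) = β ζ_{(p̂, q)}`; and
`δ^l(e_i ζ_{(e_i, q)}) = ∑_{β : t(β) = i} β ζ_{(e_{s(β)}, qβ)}`. -/
def IsLeavittDiff (k : Type) [Field k] (Q : FQ)
    (asc : ∀ i : Q.V, (∃ e, Q.t e = i) → Q.E)
    (δ : ∀ l : ℤ, PL k Q asc l →ₗ[AlgA k Q] PL k Q asc (l + 1)) : Prop :=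
  (∀ (l : ℤ) (x : Lam Q asc l) (e : Q.E) (he : Q.s e = x.i), δ l (zA x e he) = 0) ∧
  (∀ (l : ℤ) (a j b : Q.V) (p' : QP Q a j) (e : Q.E) (he : Q.s e = j) (q : QP Q a b)
      (ok : AssocPair Q asc (QP.cons p' e he) q)
      (dg : (q.length : ℤ) - ((QP.cons p' e he).length : ℤ) = l)
      (ok' : AssocPair Q asc p' q)
      (dg' : (q.length : ℤ) - (p'.length : ℤ) = l + 1),
      δ l (zE ⟨a, Q.t e, b, QP.cons p' e he, q, ok, dg⟩) =
        zA (⟨a, j, b, p', q, ok', dg'⟩ : Lam Q asc (l + 1)) e he) ∧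
  (∀ (l : ℤ) (a b : Q.V) (q : QP Q a b)
      (ok : AssocPair Q asc (QP.nil a) q)
      (dg : (q.length : ℤ) - ((QP.nil a).length : ℤ) = l),
      δ l (zE ⟨a, a, b, QP.nil a, q, ok, dg⟩) =
        ∑ e : {e : Q.E // Q.t e = a},
          zA (⟨Q.s e.1, Q.s e.1, b, QP.nil (Q.s e.1),
                QP.preCons e.1 (QP.castSrc e.2.symm q),
                assocPair_nil_left _,
                by
                  simp only [QP.length_preCons, QP.length_castSrc, QP.length] at *
                  push_cast
                  omega⟩ : Lam Q asc (l + 1)) e.1 rfl)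
/-- The `A`-submodule of `P^l` supported on the index pairs `(p, q)` whose first
component `p` has length `m`; for `m = 0` this is the component `K^l` of the
subcomplex `K•`. -/
def PartSub (k : Type) [Field k] (Q : FQ)
    (asc : ∀ i : Q.V, (∃ e, Q.t e = i) → Q.E) (l : ℤ) (m : ℕ) :
    Submodule (AlgA k Q) (PL k Q asc l) where
  carrier := {f | ∀ x : Lam Q asc l, x.p.length ≠ m → f x = 0}
  add_mem' := by
    intro f g hf hg x hx
    simp [hf x hx, hg x hx]
  zero_mem' := by intro x hx; simp
  smul_mem' := by
    intro a f hf x hx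
    simp [hf x hx]

/-- The component `K^l` of the subcomplex `K•` of the projective Leavitt complex:
the part supported on pairs `(p, q)` with `p` trivial (which vanishes in negative
degrees, as there `l(p) > 0`). -/
def Ksub (k : Type) [Field k] (Q : FQ)
    (asc : ∀ i : Q.V, (∃ e, Q.t e = i) → Q.E) (l : ℤ) :
    Submodule (AlgA k Q) (PL k Q asc l) :=
  PartSub k Q asc l 0

/-- The component `C^l_n` of the subcomplex `C•_n` of the cokernel complex
`C• = P•/K•`: the image in the quotient of the part supported on pairs `(p, q)`
with `l(p) = n - l`. -/
def Cpart (k : Type) [Field k] (Q : FQ)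
    (asc : ∀ i : Q.V, (∃ e, Q.t e = i) → Q.E) (n : ℕ) (l : ℤ) :
    Submodule (AlgA k Q) (PL k Q asc l ⧸ Ksub k Q asc l) :=
  if h : l < n then
    Submodule.map (Ksub k Q asc l).mkQ (PartSub k Q asc l (n - l).toNat)
  else ⊥

section Helpers

variable {k : Type} [Field k] {Q : FQ} {asc : ∀ i : Q.V, (∃ e, Q.t e = i) → Q.E}

lemma mem_PartSub {l : ℤ} {m : ℕ} {f : PL k Q asc l} :
    f ∈ PartSub k Q asc l m ↔ ∀ x : Lam Q asc l, x.p.length ≠ m → f x = 0 := Iff.rfl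

lemma single_mem_PartSub {l : ℤ} (x : Lam Q asc l) (y : ↥(Pmod k Q x.i)) :
    (DFinsupp.single x y : PL k Q asc l) ∈ PartSub k Q asc l x.p.length := by
  intro z hz
  apply DFinsupp.single_eq_of_ne
  rintro rfl
  exact hz rfl

lemma zA_mem_PartSub {l : ℤ} (x : Lam Q asc l) (e : Q.E) (he : Q.s e = x.i)
    {m : ℕ} (hm : x.p.length = m) :
    (zA x e he : PL k Q asc l) ∈ PartSub k Q asc l m := by
  subst hm
  exact single_mem_PartSub x _

lemma single_eq_smul_zE {l : ℤ} (x : Lam Q asc l) (y : ↥(Pmod k Q x.i)) :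
    ∃ c : AlgA k Q, (DFinsupp.single x y : PL k Q asc l) = c • (zE x : PL k Q asc l) := by
  obtain ⟨y, hy⟩ := y
  obtain ⟨c, rfl⟩ := Submodule.mem_span_singleton.1 hy
  refine ⟨c, ?_⟩
  unfold zE
  rw [← DFinsupp.single_smul]
  rfl

lemma assocPair_of_cons {a j b : Q.V} (p : QP Q a j) (e : Q.E) (he : Q.s e = j) (q : QP Q a b)
    (ok : AssocPair Q asc (QP.cons p e he) q) : AssocPair Q asc p q := by
  intro c hp hq
  exact ok c (by simp [QP.firstArrow, hp]) hq

lemma diff_zE_mem {δ : ∀ l : ℤ, PL k Q asc l →ₗ[AlgA k Q] PL k Q asc (l + 1)}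
    (hδ : IsLeavittDiff k Q asc δ) {l : ℤ} (x : Lam Q asc l) :
    δ l (zE x) ∈ PartSub k Q asc (l + 1) (x.p.length - 1) := by
  obtain ⟨a, i, b, p, q, ok, dg⟩ := x
  cases p with
  | nil =>
    rw [hδ.2.2 l a b q ok dg]
    exact Submodule.sum_mem _ fun e _ => zA_mem_PartSub _ _ _ (by simp [QP.length])
  | cons p' e he =>
    have dg' : (q.length : ℤ) - (p'.length : ℤ) = l + 1 := by
      simp only [QP.length] at dg
      push_cast at dg
      omega
    rw [hδ.2.1 l _ _ b p' e he q ok dg (assocPair_of_cons p' e he q ok) dg']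
    exact zA_mem_PartSub _ _ _ (by simp [QP.length])

lemma diff_mem {δ : ∀ l : ℤ, PL k Q asc l →ₗ[AlgA k Q] PL k Q asc (l + 1)}
    (hδ : IsLeavittDiff k Q asc δ) {l : ℤ} {m : ℕ} {f : PL k Q asc l}
    (hf : f ∈ PartSub k Q asc l m) :
    δ l f ∈ PartSub k Q asc (l + 1) (m - 1) := by
  classical
  rw [← DFinsupp.sum_single (f := f)]
  unfold DFinsupp.sum
  rw [map_sum]
  refine Submodule.sum_mem _ fun x hx => ?_
  have hm : x.p.length = m := by
    by_contra h
    exact (DFinsupp.mem_support_iff.1 hx) (hf x h)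
  obtain ⟨c, hc⟩ := single_eq_smul_zE x (f x)
  rw [hc, map_smul, ← hm]
  exact Submodule.smul_mem _ _ (diff_zE_mem hδ x)

/-- The part of an element of `P^l` supported on pairs `(p, q)` with `l(p) = n - l > 0`. -/
def projP (k : Type) [Field k] (Q : FQ) (asc : ∀ i : Q.V, (∃ e, Q.t e = i) → Q.E)
    (n : ℕ) (l : ℤ) : PL k Q asc l →ₗ[AlgA k Q] PL k Q asc l :=
  DFinsupp.filterLinearMap (AlgA k Q) (fun x : Lam Q asc l => ↥(Pmod k Q x.i))
    (fun x => (x.p.length : ℤ) = n - l ∧ x.p.length ≠ 0)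

lemma projP_pos {n : ℕ} {l : ℤ} (f : PL k Q asc l) {x : Lam Q asc l}
    (h : (x.p.length : ℤ) = n - l ∧ x.p.length ≠ 0) : projP k Q asc n l f x = f x := by
  unfold projP
  exact (DFinsupp.filter_apply _ _ _).trans (if_pos h)

lemma projP_neg {n : ℕ} {l : ℤ} (f : PL k Q asc l) {x : Lam Q asc l}
    (h : ¬ ((x.p.length : ℤ) = n - l ∧ x.p.length ≠ 0)) : projP k Q asc n l f x = 0 := by
  unfold projP
  exact (DFinsupp.filter_apply _ _ _).trans (if_neg h)

lemma projP_K (n : ℕ) (l : ℤ) :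
    Ksub k Q asc l ≤ LinearMap.ker (projP k Q asc n l) := by
  intro f hf
  rw [LinearMap.mem_ker]
  refine DFinsupp.ext fun x => ?_
  by_cases h : (x.p.length : ℤ) = n - l ∧ x.p.length ≠ 0
  · rw [projP_pos f h]
    exact hf x h.2
  · exact projP_neg f h

lemma Cpart_pos {n : ℕ} {l : ℤ} (h : l < n) : Cpart k Q asc n l =
    Submodule.map (Ksub k Q asc l).mkQ (PartSub k Q asc l (n - l).toNat) := dif_pos h

lemma Cpart_neg {n : ℕ} {l : ℤ} (h : ¬ l < n) : Cpart k Q asc n l = ⊥ := dif_neg h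

lemma Cpart_indep (l : ℤ) : iSupIndep (fun n : ℕ => Cpart k Q asc n l) := by
  intro n
  rw [Submodule.disjoint_def]
  intro x hx hx'
  have hle : (⨆ j, ⨆ (_ : j ≠ n), Cpart k Q asc j l) ≤
      LinearMap.ker ((Ksub k Q asc l).liftQ (projP k Q asc n l) (projP_K n l)) := by
    refine iSup₂_le fun j hj => ?_
    by_cases hjl : l < j
    · rw [Cpart_pos hjl, Submodule.map_le_iff_le_comap]
      intro f hf
      rw [Submodule.mem_comap, LinearMap.mem_ker, Submodule.mkQ_apply, Submodule.liftQ_apply]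
      refine DFinsupp.ext fun y => ?_
      by_cases h : (y.p.length : ℤ) = n - l ∧ y.p.length ≠ 0
      · rw [projP_pos f h]
        exact hf y (by omega)
      · exact projP_neg f h
    · rw [Cpart_neg hjl]
      exact bot_le
  have h0 := hle hx'
  by_cases hn : l < n
  · simp only [Cpart_pos hn] at hx
    obtain ⟨f, hf, rfl⟩ := hx
    rw [LinearMap.mem_ker, Submodule.mkQ_apply, Submodule.liftQ_apply] at h0
    have : f = 0 := by
      refine DFinsupp.ext fun y => ?_
      by_cases h : (y.p.length : ℤ) = n - l ∧ y.p.length ≠ 0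
      · rw [← projP_pos f h, h0]
      · exact hf y (by omega)
    rw [this, map_zero]
  · simp only [Cpart_neg hn] at hx
    simpa using hx

lemma Cpart_sup (l : ℤ) : (⨆ n : ℕ, Cpart k Q asc n l) = ⊤ := by
  classical
  rw [eq_top_iff]
  rintro x -
  obtain ⟨f, rfl⟩ := Submodule.mkQ_surjective _ x
  rw [← DFinsupp.sum_single (f := f)]
  unfold DFinsupp.sum
  rw [map_sum]
  refine Submodule.sum_mem _ fun x _ => ?_
  have hs := single_mem_PartSub x (f x)
  by_cases h : x.p.length = 0
  · rw [h] at hs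
    have h0 : (Ksub k Q asc l).mkQ (DFinsupp.single x (f x)) = 0 :=
      (Submodule.Quotient.mk_eq_zero _).2 hs
    rw [h0]
    exact Submodule.zero_mem _
  · have hd := x.deg
    have hl : l < (x.q.length : ℤ) := by omega
    refine Submodule.mem_iSup_of_mem x.q.length ?_
    rw [Cpart_pos hl]
    refine Submodule.mem_map_of_mem ?_
    have : ((x.q.length : ℤ) - l).toNat = x.p.length := by omega
    rw [this]
    exact hs

end Helpers

/-- **Decomposition of the cokernel complex (Proposition 3.1).**  Let `Q` be a finite
quiver without sources and `P•` its projective Leavitt complex, with subcomplex `K•`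
(the part with `l(p) = 0`) and cokernel complex `C• = P•/K•`.  Then `C•` decomposes as
the direct sum `C• = ⊕_{n ≥ 0} C•_n` of the subcomplexes `C•_n` (supported on the pairs
`(p,q)` with `l(p) = n - l > 0`): the differential of `P•` maps `K^l` into `K^{l+1}`,
the family `(C^l_n)_{n ≥ 0}` is independent with supremum all of `C^l`, the induced
differential of `C•` maps `C^l_n` into `C^{l+1}_n`, and each `C•_n` is bounded above:
`C^l_n = 0` for `l ≥ n`. -/
theorem cokernel_complex_decomposition (k : Type) [Field k]
    (Q : FQ) (hQ : Q.NoSources)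
    (asc : ∀ i : Q.V, (∃ e, Q.t e = i) → Q.E)
    (hasc : ∀ (i : Q.V) (h : ∃ e, Q.t e = i), Q.t (asc i h) = i)
    (δ : ∀ l : ℤ, PL k Q asc l →ₗ[AlgA k Q] PL k Q asc (l + 1))
    (hδ : IsLeavittDiff k Q asc δ) :
    ∃ hK : ∀ l : ℤ, Ksub k Q asc l ≤ (Ksub k Q asc (l + 1)).comap (δ l),
      (∀ l : ℤ, iSupIndep (fun n : ℕ => Cpart k Q asc n l)) ∧
      (∀ l : ℤ, (⨆ n : ℕ, Cpart k Q asc n l) = ⊤) ∧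
      (∀ (n : ℕ) (l : ℤ),
        Submodule.map (Submodule.mapQ (Ksub k Q asc l) (Ksub k Q asc (l + 1)) (δ l) (hK l))
          (Cpart k Q asc n l) ≤ Cpart k Q asc n (l + 1)) ∧
      (∀ (n : ℕ) (l : ℤ), (n : ℤ) ≤ l → Cpart k Q asc n l = ⊥) := by
  refine ⟨fun l f hf => diff_mem hδ hf, Cpart_indep, Cpart_sup, ?_, ?_⟩
  · intro n l
    by_cases hn : l < n
    · rw [Cpart_pos hn]
      rintro _ ⟨_, ⟨f, hf, rfl⟩, rfl⟩
      have h := diff_mem hδ hf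
      change (Ksub k Q asc (l + 1)).mkQ (δ l f) ∈ _
      by_cases hn' : l + 1 < n
      · rw [Cpart_pos hn']
        have e : ((n : ℤ) - (l + 1)).toNat = ((n : ℤ) - l).toNat - 1 := by omega
        rw [e]
        exact Submodule.mem_map_of_mem h
      · have e : ((n : ℤ) - l).toNat - 1 = 0 := by omega
        rw [e] at h
        have h0 : (Ksub k Q asc (l + 1)).mkQ (δ l f) = 0 :=
          (Submodule.Quotient.mk_eq_zero _).2 h
        rw [h0]
        exact Submodule.zero_mem _
    · rw [Cpart_neg hn, Submodule.map_bot]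
      exact bot_le
  · intro n l h
    exact Cpart_neg (by omega)
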